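/- Let ℓ be a nonzero n-dimensional sequence with finite support, S a finite downward closed subset of (Fin n →₀ ℕ) containing the support of ℓ, d the componentwise supremum of S, and p_ℓ = Σ_γ ℓ(γ)·X^γ the generating polynomial of ℓ. Then the map f ↦ rec_d(f) is a K-linear bijection from the subspace {f ∈ ann(ℓ) : support of f ⊆ S} onto the subspace {P ∈ MvPolynomial (Fin n) K : support of P ⊆ {d − γ : γ ∈ S}, and ⟨P, g⟩ = 0 for all g in the ideal generated by rec_d(p_ℓ)}. -/

import Mathlib

open MvPolynomial

/-- The action of a polynomial `f` on an `n`-dimensional sequence `ℓ`. -/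
noncomputable def seqMul {K : Type*} [Field K] {n : ℕ} (f : MvPolynomial (Fin n) K)
    (ℓ : (Fin n →₀ ℕ) → K) : (Fin n →₀ ℕ) → K :=
  fun α => ∑ γ ∈ f.support, coeff γ f * ℓ (γ + α)

/-- The apolarity pairing `⟨P, g⟩ = Σ_α (coeff α P)·(coeff α g)`. -/
noncomputable def apol {K : Type*} [Field K] {n : ℕ} (P g : MvPolynomial (Fin n) K) : K :=
  ∑ α ∈ P.support, coeff α P * coeff α g

/-- The reciprocal of a polynomial `f` with respect to a degree vector `d`:
`rec_d(f) = Σ_γ (coeff γ f)·X^(d − γ)`. -/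
noncomputable def recd {K : Type*} [Field K] {n : ℕ} (d : Fin n →₀ ℕ)
    (f : MvPolynomial (Fin n) K) : MvPolynomial (Fin n) K :=
  ∑ γ ∈ f.support, monomial (d - γ) (coeff γ f)

/-- Coefficients of the reciprocal of a polynomial whose exponents are bounded by `d`. -/
theorem coeff_recd {K : Type*} [Field K] {n : ℕ} {d : Fin n →₀ ℕ}
    {f : MvPolynomial (Fin n) K} (hf : ∀ γ ∈ f.support, γ ≤ d) (β : Fin n →₀ ℕ) :
    coeff β (recd d f) = if β ≤ d then coeff (d - β) f else 0 := by
  classical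
  simp only [recd, coeff_sum, coeff_monomial]
  split_ifs with hβ
  · rw [Finset.sum_eq_single (d - β)]
    · rw [if_pos (tsub_tsub_cancel_of_le hβ)]
    · intro γ hγ hne
      refine if_neg fun h => hne ?_
      rw [← h, tsub_tsub_cancel_of_le (hf γ hγ)]
    · intro h
      rw [notMem_support_iff.mp h, ite_self]
  · exact Finset.sum_eq_zero fun γ _ => if_neg (by rintro rfl; exact hβ tsub_le_self)

theorem mem_support_recd {K : Type*} [Field K] {n : ℕ} {d : Fin n →₀ ℕ}
    {f : MvPolynomial (Fin n) K} (hf : ∀ γ ∈ f.support, γ ≤ d) {β : Fin n →₀ ℕ} :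
    β ∈ (recd d f).support ↔ β ≤ d ∧ d - β ∈ f.support := by
  rw [mem_support_iff, coeff_recd hf, mem_support_iff]
  split_ifs with h <;> simp [h]

theorem recd_recd {K : Type*} [Field K] {n : ℕ} {d : Fin n →₀ ℕ}
    {f : MvPolynomial (Fin n) K} (hf : ∀ γ ∈ f.support, γ ≤ d) :
    recd d (recd d f) = f := by
  ext β
  rw [coeff_recd fun γ hγ => ((mem_support_recd hf).mp hγ).1]
  split_ifs with hβ
  · rw [coeff_recd hf, if_pos tsub_le_self, tsub_tsub_cancel_of_le hβ]
  · exact (notMem_support_iff.mp fun h => hβ (hf β h)).symm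

theorem apol_recd {K : Type*} [Field K] {n : ℕ} {d : Fin n →₀ ℕ}
    {f : MvPolynomial (Fin n) K} (hf : ∀ γ ∈ f.support, γ ≤ d)
    (g : MvPolynomial (Fin n) K) :
    apol (recd d f) g = ∑ γ ∈ f.support, coeff γ f * coeff (d - γ) g := by
  refine Finset.sum_nbij' (d - ·) (d - ·) ?_ ?_ ?_ ?_ ?_
  · exact fun β hβ => ((mem_support_recd hf).mp hβ).2
  · intro γ hγ
    refine (mem_support_recd hf).mpr ⟨tsub_le_self, ?_⟩
    rwa [tsub_tsub_cancel_of_le (hf γ hγ)]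
  · exact fun β hβ => tsub_tsub_cancel_of_le ((mem_support_recd hf).mp hβ).1
  · exact fun γ hγ => tsub_tsub_cancel_of_le (hf γ hγ)
  · intro β hβ
    have hle := ((mem_support_recd hf).mp hβ).1
    rw [coeff_recd hf, if_pos hle, tsub_tsub_cancel_of_le hle]

/-- Pairing `rec_d(f)` with the monomial multiples of `rec_d(p)` computes the action of `f` on
the coefficient sequence of `p`. -/
theorem apol_recd_monomial_mul_recd {K : Type*} [Field K] {n : ℕ} {d : Fin n →₀ ℕ}
    {f p : MvPolynomial (Fin n) K} (hf : ∀ γ ∈ f.support, γ ≤ d)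
    (hp : ∀ γ ∈ p.support, γ ≤ d) (α : Fin n →₀ ℕ) (c : K) :
    apol (recd d f) (monomial α c * recd d p) = c * seqMul f (fun γ => coeff γ p) α := by
  rw [apol_recd hf, seqMul, Finset.mul_sum]
  refine Finset.sum_congr rfl fun γ hγ => ?_
  rw [coeff_monomial_mul', coeff_recd hp, if_pos (tsub_le_self.trans tsub_le_self)]
  have hiff : α ≤ d - γ ↔ γ + α ≤ d := by
    rw [le_tsub_iff_left (hf γ hγ)]
  split_ifs with h
  · rw [tsub_tsub, tsub_tsub_cancel_of_le (hiff.mp h)]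
    ring
  · rw [notMem_support_iff.mp fun hm => h (hiff.mpr (hp _ hm))]
    ring

theorem apol_add_right {K : Type*} [Field K] {n : ℕ} (P g h : MvPolynomial (Fin n) K) :
    apol P (g + h) = apol P g + apol P h := by
  simp only [apol, coeff_add, mul_add, Finset.sum_add_distrib]

/-- `rec_d(f)` is orthogonal to the ideal generated by `rec_d(p)` exactly when `f` annihilates
the coefficient sequence of `p`. -/
theorem apol_recd_span_eq_zero_iff {K : Type*} [Field K] {n : ℕ} {d : Fin n →₀ ℕ}
    {f p : MvPolynomial (Fin n) K} (hf : ∀ γ ∈ f.support, γ ≤ d)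
    (hp : ∀ γ ∈ p.support, γ ≤ d) :
    (∀ g ∈ Ideal.span {recd d p}, apol (recd d f) g = 0) ↔
      seqMul f (fun γ => coeff γ p) = 0 := by
  constructor
  · intro h
    funext α
    have := h (monomial α 1 * recd d p)
      (Ideal.mul_mem_left _ _ (Ideal.mem_span_singleton_self _))
    rwa [apol_recd_monomial_mul_recd hf hp, one_mul] at this
  · intro h g hg
    obtain ⟨q, rfl⟩ := Ideal.mem_span_singleton'.mp hg
    clear hg
    induction q using MvPolynomial.monomial_add_induction_on with
    | C c =>
      rw [C_apply, apol_recd_monomial_mul_recd hf hp, h, Pi.zero_apply, mul_zero]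
    | monomial_add α c q _ _ hq =>
      rw [add_mul, apol_add_right, hq, apol_recd_monomial_mul_recd hf hp, h, Pi.zero_apply,
        mul_zero, add_zero]

theorem recd_add {K : Type*} [Field K] {n : ℕ} {d : Fin n →₀ ℕ}
    {f g : MvPolynomial (Fin n) K} (hf : ∀ γ ∈ f.support, γ ≤ d)
    (hg : ∀ γ ∈ g.support, γ ≤ d) : recd d (f + g) = recd d f + recd d g := by
  classical
  have hfg : ∀ γ ∈ (f + g).support, γ ≤ d := fun γ hγ =>
    (Finset.mem_union.mp (support_add hγ)).elim (hf γ) (hg γ)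
  ext β
  rw [coeff_add, coeff_recd hf, coeff_recd hg, coeff_recd hfg]
  split_ifs <;> simp

theorem recd_smul {K : Type*} [Field K] {n : ℕ} {d : Fin n →₀ ℕ} (c : K)
    {f : MvPolynomial (Fin n) K} (hf : ∀ γ ∈ f.support, γ ≤ d) :
    recd d (c • f) = c • recd d f := by
  ext β
  rw [coeff_smul, coeff_recd hf, coeff_recd fun γ hγ => hf γ (support_smul hγ)]
  split_ifs <;> simp

/-- Let `ℓ` be a nonzero `n`-dimensional sequence with finite support, `S` a finite downward
closed set of exponent vectors containing the support of `ℓ`, `d` the componentwise supremum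
of `S`, and `p_ℓ` the generating polynomial of `ℓ`. Then `f ↦ rec_d(f)` is a `K`-linear
bijection from the subspace `{f ∈ ann(ℓ) : supp f ⊆ S}` onto the subspace
`{P : supp P ⊆ {d − γ : γ ∈ S}, ⟨P, g⟩ = 0 for all g ∈ ⟨rec_d(p_ℓ)⟩}`. -/
theorem rec_linear_bijection_ann_orthogonal {K : Type*} [Field K] {n : ℕ} (hn : 1 ≤ n)
    (ℓ : (Fin n →₀ ℕ) → K) (hℓ : ℓ ≠ 0)
    (p : MvPolynomial (Fin n) K) (hp : ∀ γ, coeff γ p = ℓ γ)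
    (S : Finset (Fin n →₀ ℕ)) (hdc : ∀ β ∈ S, ∀ γ ≤ β, γ ∈ S)
    (hsupp : ∀ γ : Fin n →₀ ℕ, ℓ γ ≠ 0 → γ ∈ S)
    (d : Fin n →₀ ℕ) (hd : ∀ i, d i = S.sup fun β => β i)
    (A B : Submodule K (MvPolynomial (Fin n) K))
    (hA : ∀ f : MvPolynomial (Fin n) K,
      f ∈ A ↔ seqMul f ℓ = 0 ∧ ∀ γ ∈ f.support, γ ∈ S)
    (hB : ∀ P : MvPolynomial (Fin n) K,
      P ∈ B ↔ (∀ α ∈ P.support, ∃ γ ∈ S, α = d - γ) ∧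
        ∀ g ∈ Ideal.span {recd d p}, apol P g = 0) :
    ∃ e : A ≃ₗ[K] B, ∀ f : A,
      (e f : MvPolynomial (Fin n) K) = recd d (f : MvPolynomial (Fin n) K) := by
  have hSd : ∀ γ ∈ S, γ ≤ d := fun γ hγ i => by
    rw [hd i]
    exact Finset.le_sup (f := fun β : Fin n →₀ ℕ => β i) hγ
  obtain rfl : (fun γ => coeff γ p) = ℓ := funext hp
  have hpd : ∀ γ ∈ p.support, γ ≤ d := fun γ hγ =>
    hSd γ (hsupp γ (mem_support_iff.mp hγ))
  have hAd : ∀ f ∈ A, ∀ γ ∈ f.support, γ ≤ d := fun f hf γ hγ =>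
    hSd γ (((hA f).mp hf).2 γ hγ)
  have hBd : ∀ P ∈ B, ∀ α ∈ P.support, α ≤ d := fun P hP α hα => by
    obtain ⟨γ, -, rfl⟩ := ((hB P).mp hP).1 α hα
    exact tsub_le_self
  have hAB : ∀ f ∈ A, recd d f ∈ B := fun f hf => by
    refine (hB _).mpr ⟨fun α hα => ?_, ?_⟩
    · obtain ⟨hle, hmem⟩ := (mem_support_recd (hAd f hf)).mp hα
      exact ⟨d - α, ((hA f).mp hf).2 _ hmem, (tsub_tsub_cancel_of_le hle).symm⟩
    · exact (apol_recd_span_eq_zero_iff (hAd f hf) hpd).mpr ((hA f).mp hf).1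
  have hBA : ∀ P ∈ B, recd d P ∈ A := fun P hP => by
    have hrec : ∀ γ ∈ (recd d P).support, γ ≤ d := fun γ hγ =>
      ((mem_support_recd (hBd P hP)).mp hγ).1
    refine (hA _).mpr ⟨?_, fun γ hγ => ?_⟩
    · rw [← apol_recd_span_eq_zero_iff hrec hpd, recd_recd (hBd P hP)]
      exact ((hB P).mp hP).2
    · obtain ⟨hle, hmem⟩ := (mem_support_recd (hBd P hP)).mp hγ
      obtain ⟨δ, hδ, h⟩ := ((hB P).mp hP).1 _ hmem
      rwa [← tsub_tsub_cancel_of_le hle, h, tsub_tsub_cancel_of_le (hSd δ hδ)]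
  exact ⟨{
    toFun := fun f => ⟨recd d f, hAB f f.2⟩
    invFun := fun P => ⟨recd d P, hBA P P.2⟩
    map_add' := fun f g => Subtype.ext (recd_add (hAd f f.2) (hAd g g.2))
    map_smul' := fun c f => Subtype.ext (recd_smul c (hAd f f.2))
    left_inv := fun f => Subtype.ext (recd_recd (hAd f f.2))
    right_inv := fun P => Subtype.ext (recd_recd (hBd P P.2)) }, fun _ => rfl⟩
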